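/- Let P ⊆ ℝ^d be a d-dimensional lattice polytope and let k ≥ 1. Then the discrete mixed volume of k copies of P satisfies DMV(P,…,P) = Σ_{j=0}^d binom(d − j, d − k) h_j*(P), where (h_0*(P),…,h_d*(P)) is the h*-vector of P and binom(a,b) = 0 when b < 0. -/

import Mathlib

open Pointwise MeasureTheory Filter
open scoped Classical

/-- A lattice polytope in `ℝ^d`: the convex hull of finitely many integer points. -/
def IsLatticePolytope {d : ℕ} (P : Set (Fin d → ℝ)) : Prop :=
  ∃ V : Finset (Fin d → ℤ), V.Nonempty ∧
    P = convexHull ℝ ((fun z : Fin d → ℤ => fun i => (z i : ℝ)) '' ↑V)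

/-- The number of lattice points of a subset of `ℝ^d`. -/
noncomputable def latticePointCount {d : ℕ} (P : Set (Fin d → ℝ)) : ℕ :=
  Set.ncard {z : Fin d → ℤ | (fun i => (z i : ℝ)) ∈ P}

/-- The discrete mixed volume `DMV(P_1, …, P_k)`; here `∑ j ∈ J, P j` is a Minkowski
sum of sets, with the empty sum being `{0}`. -/
noncomputable def DMV {d k : ℕ} (P : Fin k → Set (Fin d → ℝ)) : ℤ :=
  ∑ J : Finset (Fin k), (-1) ^ (k - J.card) * (latticePointCount (∑ j ∈ J, P j) : ℤ)

/-- The dimension of a polytope: the dimension of its affine hull. -/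
noncomputable def polytopeDim {d : ℕ} (P : Set (Fin d → ℝ)) : ℕ :=
  Module.finrank ℝ (affineSpan ℝ P).direction

theorem Convex.nsmul_eq_natCast_smul {E : Type*} [AddCommGroup E] [Module ℝ E] {s : Set E}
    (hs : Convex ℝ s) (hne : s.Nonempty) (n : ℕ) : n • s = (n : ℝ) • s := by
  induction n with
  | zero => simp [Set.zero_smul_set hne]
  | succ n ih =>
    rw [succ_nsmul, ih, Nat.cast_succ, hs.add_smul n.cast_nonneg zero_le_one, one_smul]

theorem IsLatticePolytope.convex {d : ℕ} {P : Set (Fin d → ℝ)} (hP : IsLatticePolytope P) :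
    Convex ℝ P := by
  obtain ⟨V, -, rfl⟩ := hP
  exact convex_convexHull ℝ _

theorem IsLatticePolytope.nonempty {d : ℕ} {P : Set (Fin d → ℝ)} (hP : IsLatticePolytope P) :
    P.Nonempty := by
  obtain ⟨V, hV, rfl⟩ := hP
  exact (hV.to_set.image _).convexHull

theorem DMV_const {d k : ℕ} {P : Set (Fin d → ℝ)} (hP : IsLatticePolytope P) :
    DMV (fun _ : Fin k => P) = ∑ m ∈ Finset.range (k + 1),
      (-1) ^ (k - m) * (k.choose m : ℤ) * (latticePointCount ((m : ℝ) • P) : ℤ) := by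
  have key := Finset.sum_powerset_apply_card (x := (Finset.univ : Finset (Fin k)))
    (fun m => (-1) ^ (k - m) * (latticePointCount ((m : ℝ) • P) : ℤ))
  simp only [Finset.powerset_univ, Finset.card_univ, Fintype.card_fin, nsmul_eq_mul] at key
  simp only [DMV, Finset.sum_const, hP.convex.nsmul_eq_natCast_smul hP.nonempty, key]
  exact Finset.sum_congr rfl fun m _ => by ring

theorem sum_neg_one_pow_mul_choose_mul_add_choose (k c d : ℕ) :
    ∑ m ∈ Finset.range (k + 1), (-1 : ℤ) ^ (k - m) * (k.choose m : ℤ) * ((m + c).choose d : ℤ)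
      = if k ≤ d then (c.choose (d - k) : ℤ) else 0 := by
  have step (e : ℕ) : fwdDiff 1 (fun n : ℕ => ((n + c).choose (e + 1) : ℤ))
      = fun n => ((n + c).choose e : ℤ) := by
    funext n
    rw [fwdDiff, add_right_comm, Nat.choose_succ_succ]
    push_cast
    ring
  have iter (k d : ℕ) : (fwdDiff 1)^[k] (fun n : ℕ => ((n + c).choose d : ℤ))
      = fun n => if k ≤ d then ((n + c).choose (d - k) : ℤ) else 0 := by
    induction k generalizing d with
    | zero => simp
    | succ k ih =>
      rw [Function.iterate_succ_apply]
      cases d with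
      | zero =>
        funext y
        simp [fwdDiff_iter_eq_sum_shift]
      | succ d => simp [step, ih]
  have := fwdDiff_iter_eq_sum_shift 1 (fun n : ℕ => ((n + c).choose d : ℤ)) k 0
  simpa [iter] using this.symm


/-- **The discrete mixed volume of `k` copies of a polytope via its `h^*`-vector.**
If `P ⊆ ℝ^d` is a `d`-dimensional lattice polytope with `h^*`-vector `h`, then
`DMV(P,…,P) = ∑_{j=0}^d binom(d - j, d - k) h_j`, where the binomial coefficient is
interpreted as `0` when `d - k < 0` (i.e. when `k > d`). -/
theorem dmv_of_copies_via_hstar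
    {d k : ℕ} (hk : 1 ≤ k) (P : Set (Fin d → ℝ))
    (hP : IsLatticePolytope P) (hPdim : polytopeDim P = d)
    (h : ℕ → ℝ)
    (hh : ∀ n : ℕ, (latticePointCount ((n : ℝ) • P) : ℝ)
      = ∑ j ∈ Finset.range (d + 1), h j * ((n + d - j).choose d : ℕ)) :
    (DMV (fun _ : Fin k => P) : ℝ)
      = ∑ j ∈ Finset.range (d + 1),
          (if k ≤ d then (((d - j).choose (d - k) : ℕ) : ℝ) else 0) * h j := by
  rw [DMV_const hP]
  push_cast
  simp_rw [hh, Finset.mul_sum]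
  rw [Finset.sum_comm]
  refine Finset.sum_congr rfl fun j hj => ?_
  have hjd : j ≤ d := Finset.mem_range_succ_iff.mp hj
  have key := congrArg (Int.cast : ℤ → ℝ) (sum_neg_one_pow_mul_choose_mul_add_choose k (d - j) d)
  push_cast at key
  rw [← key, Finset.sum_mul]
  refine Finset.sum_congr rfl fun m _ => ?_
  rw [Nat.add_sub_assoc hjd]
  ring
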